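/- Let n = 2^t + m with 0 ≤ m < 2^t, and let ℓ ∈ ℕ with 2^ℓ ≤ m. If λ ⊢_o n, then the 2^t-core C_{2^t}(λ) is an odd partition of m and f_ℓ(C_{2^t}(λ)) = C_{2^t}(f_ℓ(λ)). -/

import Mathlib

namespace OddSym

open scoped Classical

/-- Remove one box from a row of size `p` (as multisets of parts). -/
def removeBox (lam : Multiset ℕ) (p : ℕ) : Multiset ℕ :=
  if p ≤ 1 then lam.erase p else (p - 1) ::ₘ lam.erase p

lemma removeBox_sum_lt {lam : Multiset ℕ} {p : ℕ} (hp : p ∈ lam) (h0 : 0 < p) :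
    (removeBox lam p).sum < lam.sum := by
  have h : p + (lam.erase p).sum = lam.sum := by
    conv_rhs => rw [← Multiset.cons_erase hp]
    simp [Multiset.sum_cons]
  unfold removeBox
  split
  · omega
  · simp only [Multiset.sum_cons]
    omega

/-- The number of standard Young tableaux of shape `lam`
(equivalently, the degree of the irreducible character of the symmetric
group labelled by `lam`), defined via the branching rule. -/
def degSYT (lam : Multiset ℕ) : ℕ :=
  if _h : lam = 0 then 1
  else ∑ p ∈ (lam.toFinset.filter (fun p => 0 < p)).attach, degSYT (removeBox lam p.1)
termination_by lam.sum
decreasing_by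
  have hp := p.2
  simp only [Finset.mem_filter, Multiset.mem_toFinset] at hp
  exact removeBox_sum_lt hp.1 hp.2

/-- `lam` is an odd partition: all parts positive and the number of standard
Young tableaux of shape `lam` (= the character degree) is odd. -/
def OddP (lam : Multiset ℕ) : Prop :=
  (∀ x ∈ lam, 0 < x) ∧ Odd (degSYT lam)

/-- The parts of `lam` sorted in weakly decreasing order. -/
def descList (lam : Multiset ℕ) : List ℕ :=
  (lam.sort (· ≤ ·)).reverse

/-- The beta-set (set of beta-numbers) of `lam` with `m` beads:
`{ lam_i + (m - i) : 1 ≤ i ≤ m }` where `lam` is padded with zero parts. -/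
def betaSet (lam : Multiset ℕ) (m : ℕ) : Finset ℕ :=
  (Finset.range m).image (fun i => (descList lam).getD i 0 + (m - 1 - i))

/-- `mu` is obtained from `lam` by removing an `e`-hook: in some beta-set of
`lam` a beta-number `x` is replaced by `x - e` (which is not a beta-number). -/
def IsHookRemoval (e : ℕ) (lam mu : Multiset ℕ) : Prop :=
  (∀ x ∈ lam, 0 < x) ∧ (∀ x ∈ mu, 0 < x) ∧ 0 < e ∧
  ∃ m x, Multiset.card lam ≤ m ∧ Multiset.card mu ≤ m ∧
    x ∈ betaSet lam m ∧ e ≤ x ∧ x - e ∉ betaSet lam m ∧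
    betaSet mu m = insert (x - e) ((betaSet lam m).erase x)

/-- The map `f_k` : for an odd partition `lam` with `2^k ≤ |lam|`, the unique
odd partition obtained from `lam` by removing a `2^k`-hook (junk value `0` if
no such partition exists). -/
noncomputable def fkOp (k : ℕ) (lam : Multiset ℕ) : Multiset ℕ :=
  if h : ∃ mu, IsHookRemoval (2 ^ k) lam mu ∧ OddP mu then h.choose else 0

/-- The partition encoded by a finite beta-set: each bead contributes a part
equal to the number of gaps below it. -/
def partOfBeta (S : Finset ℕ) : Multiset ℕ :=
  (S.val.map (fun b => b - (S.filter (fun a => a < b)).card)).filter (fun p => 0 < p)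

/-- The 2-quotient `(lam_0, lam_1)` of `lam`, computed from a beta-set with an
even number of beads via the two runners of the 2-abacus. -/
def quot2 (lam : Multiset ℕ) : Multiset ℕ × Multiset ℕ :=
  (partOfBeta (((betaSet lam (2 * Multiset.card lam)).filter (fun b => b % 2 = 0)).image
      (fun b => b / 2)),
   partOfBeta (((betaSet lam (2 * Multiset.card lam)).filter (fun b => b % 2 = 1)).image
      (fun b => b / 2)))

/-- The `e`-core of `lam`: push all beads of an `e`-abacus configuration for
`lam` up as far as possible. -/
def coreP (e : ℕ) (lam : Multiset ℕ) : Multiset ℕ :=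
  partOfBeta ((Finset.range (e * (Multiset.card lam + e))).filter
    (fun x => x / e <
      ((betaSet lam (Multiset.card lam + e)).filter (fun b => b % e = x % e)).card))

/-- Row `k` of the 2-quotient tower of `lam`: row 0 is `[lam]`, and row `k+1`
replaces each entry of row `k` by its 2-quotient pair. -/
def towerRow : ℕ → Multiset ℕ → List (Multiset ℕ)
  | 0, lam => [lam]
  | (k + 1), lam => (towerRow k lam).flatMap (fun mu => [(quot2 mu).1, (quot2 mu).2])

/-- `R_k^j(lam)`: the component of row `k` of the 2-quotient tower of `lam`
from which a `2^(j-k)`-hook is removed in the passage from `lam` to `f_j(lam)`;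
it is characterized by: row `k` for `f_j(lam)` is obtained from row `k` for
`lam` by replacing this component by its image under `f_(j-k)`. -/
noncomputable def Rcomp (k j : ℕ) (lam : Multiset ℕ) : Multiset ℕ :=
  if h : ∃ s, s < 2 ^ k ∧
      towerRow k (fkOp j lam) =
        (towerRow k lam).set s (fkOp (j - k) ((towerRow k lam).getD s 0))
  then (towerRow k lam).getD h.choose 0 else 0

/-- The beads of `S` that can be moved down by `e` positions. -/
def movable (e : ℕ) (S : Finset ℕ) : Finset ℕ :=
  S.filter (fun x => e ≤ x ∧ x - e ∉ S)

/-- The bead configuration in which the bead `x` of `S` is moved down by `e` positions. -/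
def move (e : ℕ) (S : Finset ℕ) (x : ℕ) : Finset ℕ :=
  insert (x - e) (S.erase x)

lemma mem_movable {e : ℕ} {S : Finset ℕ} {x : ℕ} :
    x ∈ movable e S ↔ x ∈ S ∧ e ≤ x ∧ x - e ∉ S := by
  simp [movable]

lemma mem_move {e : ℕ} {S : Finset ℕ} {x a : ℕ} :
    a ∈ move e S x ↔ a = x - e ∨ a ≠ x ∧ a ∈ S := by
  simp [move]

/-- The sum of `φ` over all configurations obtained from `S` by moving a bead down by `e`. -/
def hookSum (e : ℕ) (φ : Finset ℕ → ZMod 2) (S : Finset ℕ) : ZMod 2 :=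
  ∑ x ∈ movable e S, φ (move e S x)

lemma move_move_comm {e : ℕ} {S : Finset ℕ} {x y : ℕ} (hx : x ∈ movable e S)
    (hy : y ∈ movable e (move e S x)) (h1 : y ≠ x - e) (h2 : y ≠ x + e) :
    y ∈ movable e S ∧ x ∈ movable e (move e S y) ∧
      move e (move e S y) x = move e (move e S x) y := by
  simp only [mem_movable, mem_move] at *
  refine ⟨by grind, by grind, ?_⟩
  ext a
  simp only [mem_move]
  grind

lemma hookSum_hookSum {e : ℕ} (he : 0 < e) (φ : Finset ℕ → ZMod 2) (S : Finset ℕ) :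
    hookSum e (hookSum e φ) S = hookSum (2 * e) φ S := by
  unfold hookSum
  rw [Finset.sum_sigma']
  set P := (movable e S).sigma (fun x => movable e (move e S x)) with hP
  set F : (_ : ℕ) × ℕ → ZMod 2 := fun p => φ (move e (move e S p.1) p.2) with hF
  have hmem : ∀ p : (_ : ℕ) × ℕ, p ∈ P ↔
      p.1 ∈ movable e S ∧ p.2 ∈ movable e (move e S p.1) := by
    intro p; simp [hP]
  change ∑ p ∈ P, F p = _
  rw [← Finset.sum_filter_add_sum_filter_not P (fun p => p.2 = p.1 - e),
    ← Finset.sum_filter_add_sum_filter_not (P.filter (fun p => ¬ p.2 = p.1 - e))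
      (fun p => p.2 = p.1 + e),
    ← Finset.sum_filter_add_sum_filter_not (movable (2 * e) S) (fun x => x - e ∉ S)]
  have hgen : ∑ p ∈ (P.filter (fun p => ¬ p.2 = p.1 - e)).filter (fun p => ¬ p.2 = p.1 + e),
      F p = 0 := by
    have key : ∀ p ∈ (P.filter (fun p => ¬ p.2 = p.1 - e)).filter (fun p => ¬ p.2 = p.1 + e),
        p.2 ∈ movable e S ∧ p.1 ∈ movable e (move e S p.2) ∧
        move e (move e S p.2) p.1 = move e (move e S p.1) p.2 := by
      intro p hp
      simp only [Finset.mem_filter, hmem] at hp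
      exact move_move_comm hp.1.1.1 hp.1.1.2 hp.1.2 hp.2
    refine Finset.sum_involution (fun p _ => ⟨p.2, p.1⟩) ?_ ?_ ?_ ?_
    · intro p hp
      simp only [hF, (key p hp).2.2]
      exact CharTwo.add_self_eq_zero _
    · rintro ⟨x, y⟩ hp _ h
      simp only [Finset.mem_filter, hmem] at hp
      simp only [Sigma.mk.injEq, heq_eq_eq] at h
      have := hp.1.1.2
      simp only [mem_movable, mem_move] at this hp
      grind
    · intro p hp
      have hk := key p hp
      simp only [Finset.mem_filter, hmem] at hp ⊢
      refine ⟨⟨⟨hk.1, hk.2.1⟩, ?_⟩, ?_⟩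
      · have := (mem_movable.1 hp.1.1.1).2.1
        omega
      · have := (mem_movable.1 hp.1.1.2).2.1
        omega
    · intro p hp
      rfl
  rw [hgen, add_zero]
  congr 1
  · refine Finset.sum_nbij' (fun p => p.1) (fun x => ⟨x, x - e⟩) ?_ ?_ ?_ ?_ ?_
    · rintro ⟨x, y⟩ hp
      simp only [Finset.mem_filter, hmem, mem_movable, mem_move] at hp ⊢
      grind
    · intro x hx
      simp only [Finset.mem_filter, hmem, mem_movable, mem_move] at hx ⊢
      grind
    · rintro ⟨x, y⟩ hp
      simp only [Finset.mem_filter] at hp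
      simp [hp.2]
    · intro x hx
      rfl
    · rintro ⟨x, y⟩ hp
      simp only [Finset.mem_filter, hmem, mem_movable, mem_move] at hp
      simp only [hF]
      congr 1
      ext a
      simp only [mem_move]
      grind
  · refine Finset.sum_nbij' (fun p => p.2) (fun x => ⟨x - e, x⟩) ?_ ?_ ?_ ?_ ?_
    · rintro ⟨x, y⟩ hp
      simp only [Finset.mem_filter, hmem, mem_movable, mem_move] at hp ⊢
      grind
    · intro x hx
      simp only [Finset.mem_filter, hmem, mem_movable, mem_move] at hx ⊢
      grind
    · rintro ⟨x, y⟩ hp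
      simp only [Finset.mem_filter] at hp
      simp [hp.2]
    · intro x hx
      rfl
    · rintro ⟨x, y⟩ hp
      simp only [Finset.mem_filter, hmem, mem_movable, mem_move] at hp
      simp only [hF]
      congr 1
      ext a
      simp only [mem_move]
      grind

lemma hookSum_one_iterate (k : ℕ) : (hookSum 1)^[2 ^ k] = hookSum (2 ^ k) := by
  induction k with
  | zero => rfl
  | succ k ih =>
    rw [pow_succ, mul_two, Function.iterate_add, ih, ← mul_two, mul_comm]
    funext φ S
    exact hookSum_hookSum (by positivity) φ S

/-- The part contributed by a bead at position `b`. -/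
def gaps (S : Finset ℕ) (b : ℕ) : ℕ :=
  b - (S.filter (fun a => a < b)).card

lemma card_filter_lt_le (S : Finset ℕ) (b : ℕ) : (S.filter (fun a => a < b)).card ≤ b := by
  calc (S.filter (fun a => a < b)).card ≤ (Finset.range b).card :=
        Finset.card_le_card fun a ha => by simp at ha ⊢; exact ha.2
    _ = b := Finset.card_range b

lemma card_filter_lt_add_le (S : Finset ℕ) {x y : ℕ} (h : x ≤ y) :
    (S.filter (fun a => a < y)).card = (S.filter (fun a => a < x)).card +
      (S.filter (fun a => x ≤ a ∧ a < y)).card := by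
  rw [← Finset.card_union_of_disjoint]
  · congr 1
    ext a
    simp only [Finset.mem_filter, Finset.mem_union]
    grind
  · rw [Finset.disjoint_left]
    intro a
    simp only [Finset.mem_filter]
    omega

lemma card_filter_Ico_lt (S : Finset ℕ) {x y z : ℕ} (hz : z ∉ S) (h1 : x ≤ z) (h2 : z < y) :
    (S.filter (fun a => x ≤ a ∧ a < y)).card < y - x := by
  calc (S.filter (fun a => x ≤ a ∧ a < y)).card < (Finset.Ico x y).card := by
        apply Finset.card_lt_card
        rw [Finset.ssubset_iff_of_subset]
        · exact ⟨z, by simp; omega, by simp [hz]⟩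
        · intro a; simp
    _ = y - x := by simp

lemma card_filter_Ico_le (S : Finset ℕ) (x y : ℕ) :
    (S.filter (fun a => x ≤ a ∧ a < y)).card ≤ y - x := by
  calc (S.filter (fun a => x ≤ a ∧ a < y)).card ≤ (Finset.Ico x y).card := by
        apply Finset.card_le_card
        intro a; simp
    _ = y - x := by simp

lemma gaps_mono (S : Finset ℕ) {x y : ℕ} (h : x ≤ y) : gaps S x ≤ gaps S y := by
  have h1 := card_filter_lt_add_le S h
  have h2 := card_filter_Ico_le S x y
  unfold gaps
  omega

lemma gaps_lt_of_notMem (S : Finset ℕ) {x y z : ℕ} (hz : z ∉ S) (h1 : x ≤ z) (h2 : z < y) :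
    gaps S x < gaps S y := by
  have h3 := card_filter_lt_add_le S (h1.trans h2.le)
  have h4 := card_filter_Ico_lt S hz h1 h2
  have h5 := card_filter_lt_le S x
  unfold gaps
  omega

lemma card_filter_lt_pred (S : Finset ℕ) {x : ℕ} (hx : 1 ≤ x) :
    (S.filter (fun a => a < x)).card = (S.filter (fun a => a < x - 1)).card +
      if x - 1 ∈ S then 1 else 0 := by
  rw [card_filter_lt_add_le S (Nat.sub_le x 1)]
  congr 1
  have : S.filter (fun a => x - 1 ≤ a ∧ a < x) = S.filter (fun a => a = x - 1) := by
    apply Finset.filter_congr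
    intro a _
    omega
  rw [this, Finset.filter_eq']
  split <;> simp

lemma gaps_pred_of_mem (S : Finset ℕ) {x : ℕ} (hx : 1 ≤ x) (h : x - 1 ∈ S) :
    gaps S (x - 1) = gaps S x := by
  have := card_filter_lt_pred S hx
  simp only [h, if_true] at this
  unfold gaps
  omega

lemma gaps_pos_of_notMem (S : Finset ℕ) {x : ℕ} (hx : 1 ≤ x) (h : x - 1 ∉ S) :
    0 < gaps S x :=
  (Nat.zero_le _).trans_lt (gaps_lt_of_notMem S h le_rfl (by omega))

lemma card_filter_move_one (S : Finset ℕ) {x b : ℕ} (hx : x ∈ movable 1 S) (hb : b ≠ x) :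
    ((move 1 S x).filter (fun a => a < b)).card = (S.filter (fun a => a < b)).card := by
  rw [mem_movable] at hx
  by_cases h : x < b
  · have : (move 1 S x).filter (fun a => a < b) = move 1 (S.filter (fun a => a < b)) x := by
      ext a
      simp only [mem_move, Finset.mem_filter]
      grind
    rw [this, move, Finset.card_insert_of_notMem, Finset.card_erase_of_mem]
    · have : 0 < (S.filter (fun a => a < b)).card := Finset.card_pos.2 ⟨x, by simp; exact ⟨hx.1, h⟩⟩
      omega
    · simp; exact ⟨hx.1, h⟩
    · simp [hx.2.2]
  · congr 1
    ext a
    simp only [mem_move, Finset.mem_filter]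
    grind

lemma card_filter_move_one_self (S : Finset ℕ) {x : ℕ} (hx : x ∈ movable 1 S) :
    ((move 1 S x).filter (fun a => a < x - 1)).card = (S.filter (fun a => a < x)).card := by
  have h := mem_movable.1 hx
  rw [card_filter_move_one S hx (by omega), card_filter_lt_pred S h.2.1]
  simp [h.2.2]

lemma partOfBeta_eq (S : Finset ℕ) :
    partOfBeta S = (S.val.map (gaps S)).filter (fun p => 0 < p) := rfl

lemma partOfBeta_pos (S : Finset ℕ) : ∀ x ∈ partOfBeta S, 0 < x := by
  intro x hx
  exact (Multiset.mem_filter.1 hx).2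

lemma card_partOfBeta_le (S : Finset ℕ) : Multiset.card (partOfBeta S) ≤ S.card := by
  rw [partOfBeta_eq]
  calc _ ≤ Multiset.card (S.val.map (gaps S)) := Multiset.card_le_card (Multiset.filter_le _ _)
    _ = S.card := by simp

lemma partOfBeta_move_one (S : Finset ℕ) {x : ℕ} (hx : x ∈ movable 1 S) :
    partOfBeta (move 1 S x) = removeBox (partOfBeta S) (gaps S x) := by
  have h := mem_movable.1 hx
  have hS : S.val = x ::ₘ (S.erase x).val := by
    rw [Finset.erase_val, Multiset.cons_erase h.1]
  have hM : (move 1 S x).val = (x - 1) ::ₘ (S.erase x).val := by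
    rw [move, Finset.insert_val_of_notMem]
    simp [h.2.2]
  have hpos := gaps_pos_of_notMem S h.2.1 h.2.2
  have hx1 : gaps (move 1 S x) (x - 1) = gaps S x - 1 := by
    unfold gaps
    rw [card_filter_move_one_self S hx]
    omega
  have hmap : (S.erase x).val.map (gaps (move 1 S x)) = (S.erase x).val.map (gaps S) := by
    apply Multiset.map_congr rfl
    intro b hb
    have hb' : b ≠ x := (Finset.mem_erase.1 hb).1
    unfold gaps
    rw [card_filter_move_one S hx hb']
  rw [partOfBeta_eq, partOfBeta_eq, hM, Multiset.map_cons, hmap, hx1, hS, Multiset.map_cons,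
    Multiset.filter_cons_of_pos _ hpos, removeBox, Multiset.erase_cons_head]
  split
  · rw [Multiset.filter_cons_of_neg]
    omega
  · rw [Multiset.filter_cons_of_pos]
    omega

lemma degSYT_partOfBeta (S : Finset ℕ) (h : partOfBeta S ≠ 0) :
    degSYT (partOfBeta S) = ∑ x ∈ movable 1 S, degSYT (partOfBeta (move 1 S x)) := by
  rw [degSYT, dif_neg h,
    Finset.sum_attach (((partOfBeta S).toFinset.filter (fun p => 0 < p)))
      (fun p => degSYT (removeBox (partOfBeta S) p))]
  symm
  refine Finset.sum_bij (fun x _ => gaps S x) ?_ ?_ ?_ ?_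
  · intro x hx
    have h := mem_movable.1 hx
    have hpos := gaps_pos_of_notMem S h.2.1 h.2.2
    simp only [Finset.mem_filter, Multiset.mem_toFinset, partOfBeta_eq, Multiset.mem_filter,
      Multiset.mem_map]
    exact ⟨⟨⟨x, h.1, rfl⟩, hpos⟩, hpos⟩
  · have aux : ∀ x ∈ movable 1 S, ∀ y ∈ movable 1 S, gaps S x = gaps S y → ¬ x < y := by
      intro x _ y hy hxy hlt
      have h := mem_movable.1 hy
      have := gaps_lt_of_notMem S h.2.2 (show x ≤ y - 1 by omega) (show y - 1 < y by omega)
      omega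
    intro x hx y hy hxy
    have h1 := aux x hx y hy hxy
    have h2 := aux y hy x hx hxy.symm
    omega
  · intro p hp
    simp only [Finset.mem_filter, Multiset.mem_toFinset, partOfBeta_eq, Multiset.mem_filter,
      Multiset.mem_map] at hp
    obtain ⟨⟨hex, hp0⟩, -⟩ := hp
    have hex' : ∃ a, a ∈ S ∧ gaps S a = p := hex
    have hspec := Nat.find_spec hex'
    have hmin := fun {m} => Nat.find_min (H := hex') (m := m)
    set x := Nat.find hex'
    have hx1 : 1 ≤ x := by
      by_contra h0
      have : x = 0 := by omega
      rw [this] at hspec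
      have := hspec.2
      simp [gaps] at this
      omega
    refine ⟨x, ?_, hspec.2⟩
    rw [mem_movable]
    refine ⟨hspec.1, hx1, fun hmem => hmin (m := x - 1) (by omega) ⟨hmem, ?_⟩⟩
    rw [gaps_pred_of_mem S hx1 hmem, hspec.2]
  · intro x hx
    rw [partOfBeta_move_one S hx]

lemma sum_card_filter_lt (S : Finset ℕ) :
    ∑ b ∈ S, (S.filter (fun a => a < b)).card = ∑ i ∈ Finset.range S.card, i := by
  induction S using Finset.induction_on_max with
  | empty => simp
  | insert a s hlt ih =>
    have ha : a ∉ s := fun h => lt_irrefl _ (hlt a h)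
    rw [Finset.sum_insert ha, Finset.card_insert_of_notMem ha, Finset.sum_range_succ, ← ih,
      add_comm]
    congr 1
    · apply Finset.sum_congr rfl
      intro b hb
      congr 1
      ext c
      have := hlt b hb
      simp only [Finset.mem_filter, Finset.mem_insert]
      grind
    · congr 1
      ext c
      have := hlt c
      simp only [Finset.mem_filter, Finset.mem_insert]
      grind

lemma partOfBeta_sum (S : Finset ℕ) :
    (partOfBeta S).sum + ∑ i ∈ Finset.range S.card, i = ∑ b ∈ S, b := by
  have h : (partOfBeta S).sum = ∑ b ∈ S, gaps S b := by
    rw [partOfBeta_eq, Finset.sum]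
    conv_rhs => rw [← Multiset.filter_add_not (fun p => 0 < p) (S.val.map (gaps S))]
    rw [Multiset.sum_add]
    have : (Multiset.filter (fun p => ¬ 0 < p) (S.val.map (gaps S))).sum = 0 := by
      rw [Multiset.sum_eq_zero_iff]
      intro x hx
      have := (Multiset.mem_filter.1 hx).2
      omega
    omega
  rw [h, ← sum_card_filter_lt, ← Finset.sum_add_distrib]
  apply Finset.sum_congr rfl
  intro b _
  have := card_filter_lt_le S b
  unfold gaps
  omega

lemma card_move {e : ℕ} {S : Finset ℕ} {x : ℕ} (hx : x ∈ movable e S) :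
    (move e S x).card = S.card := by
  have h := mem_movable.1 hx
  rw [move, Finset.card_insert_of_notMem (by simp [h.2.2]), Finset.card_erase_of_mem h.1]
  have : 0 < S.card := Finset.card_pos.2 ⟨x, h.1⟩
  omega

lemma partOfBeta_move_sum {e : ℕ} {S : Finset ℕ} {x : ℕ} (hx : x ∈ movable e S) :
    (partOfBeta (move e S x)).sum + e = (partOfBeta S).sum := by
  have h := mem_movable.1 hx
  have h1 := partOfBeta_sum S
  have h2 := partOfBeta_sum (move e S x)
  have h3 : ∑ b ∈ move e S x, b + e = ∑ b ∈ S, b := by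
    rw [move, Finset.sum_insert (by simp [h.2.2]), ← Finset.sum_erase_add _ _ h.1]
    omega
  rw [card_move hx] at h2
  omega

/-- The parity of the degree of the partition encoded by `S`. -/
def degParity (S : Finset ℕ) : ZMod 2 := degSYT (partOfBeta S)

lemma degParity_eq_iterate (n : ℕ) : ∀ S : Finset ℕ, (partOfBeta S).sum = n →
    degParity S = (hookSum 1)^[n] (fun T => if partOfBeta T = 0 then 1 else 0) S := by
  induction n with
  | zero =>
    intro S hS
    have : partOfBeta S = 0 := by
      rw [Multiset.eq_zero_iff_forall_notMem]
      intro x hx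
      have h1 := Multiset.sum_eq_zero_iff.1 hS x hx
      have h2 := partOfBeta_pos S x hx
      omega
    rw [degParity, this, degSYT]
    simp [this]
  | succ n ih =>
    intro S hS
    have h0 : partOfBeta S ≠ 0 := by
      intro h
      simp [h] at hS
    rw [Function.iterate_succ_apply', degParity, degSYT_partOfBeta S h0, Nat.cast_sum]
    refine Finset.sum_congr rfl fun x hx => ?_
    have := partOfBeta_move_sum hx
    exact ih _ (by omega)

lemma degParity_eq_sum_hooks (k : ℕ) (S : Finset ℕ) (h : 2 ^ k ≤ (partOfBeta S).sum) :
    degParity S = ∑ x ∈ movable (2 ^ k) S, degParity (move (2 ^ k) S x) := by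
  obtain ⟨r, hr⟩ := Nat.exists_eq_add_of_le h
  rw [degParity_eq_iterate _ S hr, Function.iterate_add_apply, hookSum_one_iterate]
  refine Finset.sum_congr rfl fun x hx => ?_
  have := partOfBeta_move_sum hx
  rw [degParity_eq_iterate r]
  omega

lemma two_mul_le_of_movable_ne {e : ℕ} {S : Finset ℕ} {x y : ℕ} (hx : x ∈ movable e S)
    (hy : y ∈ movable e S) (hxy : x ≠ y) : 2 * e ≤ (partOfBeta S).sum := by
  have hy' : y ∈ movable e (move e S x) := by
    simp only [mem_movable, mem_move] at *
    grind
  have h1 := partOfBeta_move_sum hx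
  have h2 := partOfBeta_move_sum hy'
  omega

lemma sub_mem_of_sum_lt {e : ℕ} {S : Finset ℕ} (h : (partOfBeta S).sum < e) {x : ℕ}
    (hx : x ∈ S) (hxe : e ≤ x) : x - e ∈ S := by
  by_contra hn
  have := partOfBeta_move_sum (mem_movable.2 ⟨hx, hxe, hn⟩)
  omega

/-- If `z` is moved down by `e` in `S` and `x` by `d`, this is the bead whose move down by `d`
completes the square after the move of `z`. -/
def transferBead (d e z x : ℕ) : ℕ :=
  if x = z then z - e else if x = z - e + d then z + d else x

lemma transferBead_injOn {d e z : ℕ} {S : Finset ℕ} (hz : z ∈ movable e S)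
    {x y : ℕ} (hx : x ∈ movable d S) (hy : y ∈ movable d S)
    (h : transferBead d e z x = transferBead d e z y) : x = y := by
  unfold transferBead at h
  simp only [mem_movable] at *
  grind

/-- Completing the square of hook removals: a move by `d` followed by a move by `e` in a
configuration of `e`-weight one descends to a move by `d` of the `e`-core. -/
lemma move_move_eq_transfer {d e : ℕ} (hd : 0 < d) (hde : d < e) {S : Finset ℕ}
    (hS : (partOfBeta S).sum < 2 * e) {z x u : ℕ} (hz : z ∈ movable e S)
    (hx : x ∈ movable d S) (hu : u ∈ movable e (move d S x)) :
    transferBead d e z x ∈ movable d (move e S z) ∧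
      move e (move d S x) u = move d (move e S z) (transferBead d e z x) := by
  have hsumC := partOfBeta_move_sum hz
  have hsumM := partOfBeta_move_sum hx
  have hcore : ∀ a ∈ move e S z, e ≤ a → a - e ∈ move e S z := fun a ha hae =>
    sub_mem_of_sum_lt (by omega) ha hae
  have huniq : ∀ v ∈ movable e (move d S x), v = u := fun v hv => by
    by_contra hne
    have := two_mul_le_of_movable_ne hv hu hne
    omega
  have hcu := hcore u
  have hzz := huniq z
  clear hcore huniq hsumC hsumM hS
  unfold transferBead
  simp only [mem_movable, mem_move] at *
  split_ifs with h1 h2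
  · subst h1
    have : u = x - d := by grind
    subst this
    refine ⟨by grind, ?_⟩
    ext a
    simp only [mem_move]
    grind
  · have : u = z + d := by grind
    subst this
    refine ⟨by grind, ?_⟩
    ext a
    simp only [mem_move]
    grind
  · have : z = u := by grind
    subst this
    refine ⟨by grind, ?_⟩
    ext a
    simp only [mem_move]
    grind

lemma sum_zmod_two_eq_card_filter {ι : Type*} (s : Finset ι) (f : ι → ZMod 2) :
    ∑ i ∈ s, f i = ((s.filter (fun i => f i = 1)).card : ZMod 2) := by
  rw [Finset.card_filter, Nat.cast_sum]
  refine Finset.sum_congr rfl fun i _ => ?_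
  generalize f i = a
  revert a
  decide

lemma odd_card_filter_movable {k : ℕ} {S : Finset ℕ} (hS : degParity S = 1)
    (h : 2 ^ k ≤ (partOfBeta S).sum) :
    Odd ((movable (2 ^ k) S).filter (fun x => degParity (move (2 ^ k) S x) = 1)).card := by
  rw [← ZMod.natCast_eq_one_iff_odd, ← sum_zmod_two_eq_card_filter, ← degParity_eq_sum_hooks k S h,
    hS]

lemma exists_movable_odd {k : ℕ} {S : Finset ℕ} (hS : degParity S = 1)
    (h : 2 ^ k ≤ (partOfBeta S).sum) :
    ∃ x ∈ movable (2 ^ k) S, degParity (move (2 ^ k) S x) = 1 := by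
  obtain ⟨x, hx⟩ := Finset.card_pos.1 (odd_card_filter_movable hS h).pos
  exact ⟨x, (Finset.mem_filter.1 hx).1, (Finset.mem_filter.1 hx).2⟩

/-- Removal of a `2 ^ l`-hook with odd remainder is unique. -/
lemma movable_odd_unique (l n : ℕ) : ∀ S : Finset ℕ, (partOfBeta S).sum = n →
    degParity S = 1 → 2 ^ l ≤ n → ∀ x ∈ movable (2 ^ l) S, ∀ y ∈ movable (2 ^ l) S,
    degParity (move (2 ^ l) S x) = 1 → degParity (move (2 ^ l) S y) = 1 → x = y := by
  induction n using Nat.strong_induction_on with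
  | _ n ih =>
  intro S hn hS hl x hx y hy hgx hgy
  have hn0 : n ≠ 0 := by
    have := Nat.two_pow_pos l
    omega
  obtain ⟨t, ht1, ht2⟩ : ∃ t, 2 ^ t ≤ n ∧ n < 2 * 2 ^ t :=
    ⟨Nat.log 2 n, Nat.pow_log_le_self 2 hn0, by
      rw [← pow_succ']; exact Nat.lt_pow_succ_log_self (by norm_num) n⟩
  have hlt : l ≤ t := by
    by_contra h
    have : 2 ^ (t + 1) ≤ 2 ^ l := Nat.pow_le_pow_right (by norm_num) (by omega)
    rw [pow_succ] at this
    omega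
  rcases hlt.eq_or_lt with rfl | hlt
  · by_contra hne
    have := two_mul_le_of_movable_ne hx hy hne
    omega
  have hd : 0 < 2 ^ l := by positivity
  have hde : 2 ^ l < 2 ^ t := Nat.pow_lt_pow_right (by norm_num) hlt
  obtain ⟨z, hz, hgz⟩ := exists_movable_odd hS (k := t) (by omega)
  have hsz := partOfBeta_move_sum hz
  by_cases hm : 2 ^ t + 2 ^ l ≤ n
  · have step : ∀ w ∈ movable (2 ^ l) S, degParity (move (2 ^ l) S w) = 1 →
        transferBead (2 ^ l) (2 ^ t) z w ∈ movable (2 ^ l) (move (2 ^ t) S z) ∧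
        degParity (move (2 ^ l) (move (2 ^ t) S z) (transferBead (2 ^ l) (2 ^ t) z w)) = 1 := by
      intro w hw hgw
      have hsw := partOfBeta_move_sum hw
      obtain ⟨u, hu, hgu⟩ := exists_movable_odd hgw (k := t) (by omega)
      obtain ⟨h1, h2⟩ := move_move_eq_transfer hd hde (by omega) hz hw hu
      exact ⟨h1, h2 ▸ hgu⟩
    obtain ⟨hx1, hx2⟩ := step x hx hgx
    obtain ⟨hy1, hy2⟩ := step y hy hgy
    exact transferBead_injOn hz hx hy
      (ih (n - 2 ^ t) (by omega) _ (by omega) hgz (by omega) _ hx1 _ hy1 hx2 hy2)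
  · have hsub : (movable (2 ^ l) S).filter (fun w => degParity (move (2 ^ l) S w) = 1) ⊆
        {z, z - 2 ^ t + 2 ^ l} := by
      intro w hw
      have hw1 := (Finset.mem_filter.1 hw).1
      rw [Finset.mem_insert, Finset.mem_singleton]
      by_contra hne
      have : w ∈ movable (2 ^ l) (move (2 ^ t) S z) := by
        simp only [mem_movable, mem_move] at *
        grind
      have := partOfBeta_move_sum this
      omega
    have hcard := (Finset.card_le_card hsub).trans Finset.card_le_two
    have hodd := odd_card_filter_movable hS (k := l) (by omega)
    have hone : ((movable (2 ^ l) S).filter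
        (fun w => degParity (move (2 ^ l) S w) = 1)).card ≤ 1 := by
      obtain ⟨r, hr⟩ := hodd
      omega
    exact Finset.card_le_one.1 hone x (Finset.mem_filter.2 ⟨hx, hgx⟩) y
      (Finset.mem_filter.2 ⟨hy, hgy⟩)

lemma coe_descList (lam : Multiset ℕ) : (descList lam : Multiset ℕ) = lam := by
  rw [descList, Multiset.coe_reverse, Multiset.sort_eq]

lemma length_descList (lam : Multiset ℕ) : (descList lam).length = Multiset.card lam := by
  simp [descList]

lemma descList_getD_antitone (lam : Multiset ℕ) {i j : ℕ} (hij : i < j) :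
    (descList lam).getD j 0 ≤ (descList lam).getD i 0 := by
  have hp : (descList lam).Pairwise (fun a b => b ≤ a) := by
    rw [descList, List.pairwise_reverse]
    exact Multiset.pairwise_sort lam (· ≤ ·)
  by_cases hj : j < (descList lam).length
  · rw [List.getD_eq_getElem _ _ hj, List.getD_eq_getElem _ _ (hij.trans hj)]
    exact List.pairwise_iff_getElem.1 hp i j _ _ hij
  · rw [List.getD_eq_default _ _ (by omega)]
    exact Nat.zero_le _

/-- The `i`-th largest bead of the beta-set of `lam` with `m` beads. -/
def bead (lam : Multiset ℕ) (m i : ℕ) : ℕ :=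
  (descList lam).getD i 0 + (m - 1 - i)

lemma bead_lt {lam : Multiset ℕ} {m i j : ℕ} (hij : i < j) (hj : j < m) :
    bead lam m j < bead lam m i := by
  have := descList_getD_antitone lam hij
  unfold bead
  omega

lemma betaSet_eq_image (lam : Multiset ℕ) (m : ℕ) :
    betaSet lam m = (Finset.range m).image (bead lam m) := rfl

lemma bead_injOn (lam : Multiset ℕ) (m : ℕ) :
    Set.InjOn (bead lam m) (Finset.range m : Finset ℕ) := by
  intro i hi j hj h
  simp only [Finset.coe_range, Set.mem_Iio] at hi hj
  rcases lt_trichotomy i j with hlt | heq | hlt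
  · have := bead_lt (lam := lam) hlt hj
    omega
  · exact heq
  · have := bead_lt (lam := lam) hlt hi
    omega

lemma card_betaSet (lam : Multiset ℕ) (m : ℕ) : (betaSet lam m).card = m := by
  rw [betaSet_eq_image, Finset.card_image_of_injOn (bead_injOn lam m), Finset.card_range]

lemma gaps_bead {lam : Multiset ℕ} {m i : ℕ} (hi : i < m) :
    gaps (betaSet lam m) (bead lam m i) = (descList lam).getD i 0 := by
  have h : (betaSet lam m).filter (fun a => a < bead lam m i) =
      (Finset.Ioo i m).image (bead lam m) := by
    ext a
    simp only [betaSet_eq_image, Finset.mem_filter, Finset.mem_image, Finset.mem_range,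
      Finset.mem_Ioo]
    constructor
    · rintro ⟨⟨j, hj, rfl⟩, hlt⟩
      refine ⟨j, ⟨?_, hj⟩, rfl⟩
      by_contra hle
      rcases (not_lt.1 hle).eq_or_lt with rfl | hji
      · exact lt_irrefl _ hlt
      · have := bead_lt (lam := lam) hji hi
        omega
    · rintro ⟨j, ⟨hij, hj⟩, rfl⟩
      exact ⟨⟨j, hj, rfl⟩, bead_lt hij hj⟩
  rw [gaps, h, Finset.card_image_of_injOn, Nat.card_Ioo, bead]
  · omega
  · exact (bead_injOn lam m).mono fun j hj => by simp at hj ⊢; exact hj.2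

lemma map_getD_range (L : List ℕ) (k : ℕ) :
    (List.range (L.length + k)).map (fun i => L.getD i 0) = L ++ List.replicate k 0 := by
  apply List.ext_getElem
  · simp
  · intro i h1 h2
    simp only [List.getElem_map, List.getElem_range, List.getElem_append]
    split
    · rename_i h
      rw [List.getD_eq_getElem _ _ h]
    · rw [List.getD_eq_default _ _ (by omega)]
      simp

lemma partOfBeta_betaSet {lam : Multiset ℕ} {m : ℕ} (hpos : ∀ x ∈ lam, 0 < x)
    (hm : Multiset.card lam ≤ m) : partOfBeta (betaSet lam m) = lam := by
  obtain ⟨k, rfl⟩ := Nat.exists_eq_add_of_le hm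
  have h1 : (betaSet lam (Multiset.card lam + k)).val.map
      (gaps (betaSet lam (Multiset.card lam + k))) = lam + Multiset.replicate k 0 := by
    conv_lhs =>
      enter [2]
      rw [betaSet_eq_image, Finset.image_val_of_injOn (bead_injOn _ _)]
    rw [Multiset.map_map]
    have h2 : (Finset.range (Multiset.card lam + k)).val.map
        (gaps (betaSet lam (Multiset.card lam + k)) ∘ bead lam (Multiset.card lam + k)) =
        (Finset.range (Multiset.card lam + k)).val.map (fun i => (descList lam).getD i 0) :=
      Multiset.map_congr rfl fun i hi => gaps_bead (Finset.mem_range.1 hi)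
    rw [h2, Finset.range_val, ← Multiset.coe_range, Multiset.map_coe, ← length_descList,
      map_getD_range, ← Multiset.coe_add, coe_descList, Multiset.coe_replicate]
  rw [partOfBeta_eq, h1, Multiset.filter_add, Multiset.filter_eq_self.2 hpos,
    Multiset.filter_eq_nil.2, add_zero]
  intro a ha
  rw [Multiset.eq_of_mem_replicate ha]
  exact lt_irrefl 0

lemma map_gaps_eq (S : Finset ℕ) : S.val.map (gaps S) =
    partOfBeta S + Multiset.replicate (S.card - Multiset.card (partOfBeta S)) 0 := by
  rw [partOfBeta_eq]
  conv_lhs => rw [← Multiset.filter_add_not (fun p => 0 < p) (S.val.map (gaps S))]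
  congr 1
  have hcard := congrArg Multiset.card
    (Multiset.filter_add_not (fun p => 0 < p) (S.val.map (gaps S)))
  rw [Multiset.card_add, Multiset.card_map, Finset.card_val] at hcard
  rw [Multiset.eq_replicate]
  refine ⟨by omega, fun b hb => ?_⟩
  have := (Multiset.mem_filter.1 hb).2
  omega

lemma eq_of_map_gaps_eq (S : Finset ℕ) : ∀ T : Finset ℕ,
    S.val.map (gaps S) = T.val.map (gaps T) → S = T := by
  induction S using Finset.induction_on_max with
  | empty =>
    intro T h
    have := congrArg Multiset.card h
    simp at this
    exact (Finset.card_eq_zero.1 this.symm).symm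
  | insert a s hlt ih =>
    intro T h
    have has : a ∉ s := fun h => lt_irrefl _ (hlt a h)
    have hcard := congrArg Multiset.card h
    simp only [Multiset.card_map, Finset.card_val, Finset.card_insert_of_notMem has] at hcard
    have hT : T.Nonempty := Finset.card_pos.1 (by omega)
    have split : ∀ (b : ℕ) (U : Finset ℕ), (∀ x ∈ U, x < b) →
        (insert b U).val.map (gaps (insert b U)) = (b - U.card) ::ₘ U.val.map (gaps U) := by
      intro b U hU
      have hbU : b ∉ U := fun h => lt_irrefl _ (hU b h)
      rw [Finset.insert_val_of_notMem hbU, Multiset.map_cons]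
      congr 1
      · rw [gaps]
        congr 2
        ext c
        have := hU c
        simp only [Finset.mem_filter, Finset.mem_insert]
        grind
      · refine Multiset.map_congr rfl fun x hx => ?_
        have := hU x hx
        rw [gaps, gaps]
        congr 2
        ext c
        simp only [Finset.mem_filter, Finset.mem_insert]
        grind
    set b := T.max' hT with hb
    have hTb : T = insert b (T.erase b) := (Finset.insert_erase (T.max'_mem hT)).symm
    have hTlt : ∀ x ∈ T.erase b, x < b := fun x hx => by
      have h1 := Finset.mem_erase.1 hx
      exact lt_of_le_of_ne (T.le_max' x h1.2) h1.1
    have hTcard : (T.erase b).card = s.card := by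
      rw [Finset.card_erase_of_mem (T.max'_mem hT)]
      omega
    have hle : ∀ (V : Finset ℕ) (y : ℕ), (∀ x ∈ V, x ≤ y) → ∀ p ∈ V.val.map (gaps V),
        p ≤ gaps V y := by
      intro V y hV p hp
      obtain ⟨x, hx, rfl⟩ := Multiset.mem_map.1 hp
      exact gaps_mono V (hV x hx)
    have hga : gaps (insert a s) a = gaps T b := by
      apply le_antisymm
      · refine hle T b (fun x hx => T.le_max' x hx) _ ?_
        rw [← h]
        exact Multiset.mem_map_of_mem _ (Finset.mem_insert_self a s)
      · refine hle (insert a s) a (fun x hx => ?_) _ ?_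
        · rcases Finset.mem_insert.1 hx with rfl | hx
          · exact le_rfl
          · exact (hlt x hx).le
        · rw [h]
          exact Multiset.mem_map_of_mem _ (T.max'_mem hT)
    have hgaps : ∀ (c : ℕ) (U : Finset ℕ), (∀ x ∈ U, x < c) →
        gaps (insert c U) c = c - U.card ∧ U.card ≤ c := by
      intro c U hU
      have hfil : (insert c U).filter (fun x => x < c) = U := by
        ext x
        have := hU x
        simp only [Finset.mem_filter, Finset.mem_insert]
        grind
      have := card_filter_lt_le (insert c U) c
      rw [gaps, hfil]
      rw [hfil] at this
      exact ⟨rfl, this⟩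
    have hab : a = b := by
      have h1 := hgaps a s hlt
      have h2 := hgaps b (T.erase b) hTlt
      rw [← hTb] at h2
      omega
    rw [hTb, split a s hlt, split b _ hTlt, hTcard, hab, Multiset.cons_inj_right] at h
    rw [hTb, hab, ← ih _ h]

lemma betaSet_partOfBeta (S : Finset ℕ) : betaSet (partOfBeta S) S.card = S := by
  apply eq_of_map_gaps_eq
  rw [map_gaps_eq, map_gaps_eq, card_betaSet,
    partOfBeta_betaSet (partOfBeta_pos S) (card_partOfBeta_le S)]

lemma mem_betaSet_succ {lam : Multiset ℕ} {m a : ℕ} (hm : Multiset.card lam ≤ m) :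
    a ∈ betaSet lam (m + 1) ↔ a = 0 ∨ 1 ≤ a ∧ a - 1 ∈ betaSet lam m := by
  have hlast : bead lam (m + 1) m = 0 := by
    rw [bead, List.getD_eq_default _ _ (by rw [length_descList]; exact hm)]
    omega
  have hstep : ∀ i < m, bead lam (m + 1) i = bead lam m i + 1 := by
    intro i hi
    unfold bead
    omega
  simp only [betaSet_eq_image, Finset.mem_image, Finset.mem_range]
  constructor
  · rintro ⟨i, hi, rfl⟩
    rcases (Nat.lt_succ_iff.1 hi).eq_or_lt with rfl | him
    · exact Or.inl hlast
    · rw [hstep i him]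
      exact Or.inr ⟨by omega, i, him, by omega⟩
  · rintro (rfl | ⟨ha, i, hi, h⟩)
    · exact ⟨m, by omega, hlast⟩
    · exact ⟨i, by omega, by rw [hstep i hi]; omega⟩

lemma IsHookRemoval.exists_move {e : ℕ} {lam mu : Multiset ℕ} (h : IsHookRemoval e lam mu) :
    ∃ m₀, Multiset.card lam ≤ m₀ ∧ Multiset.card mu ≤ m₀ ∧ ∀ m, m₀ ≤ m →
      ∃ x ∈ movable e (betaSet lam m), betaSet mu m = move e (betaSet lam m) x := by
  obtain ⟨-, -, he, m₀, x, h1, h2, h3, h4, h5, h6⟩ := h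
  refine ⟨m₀, h1, h2, fun m hm => ?_⟩
  induction m, hm using Nat.le_induction with
  | base => exact ⟨x, mem_movable.2 ⟨h3, h4, h5⟩, h6⟩
  | succ m hm ih =>
    obtain ⟨y, hy, hmu⟩ := ih
    rw [mem_movable] at hy
    refine ⟨y + 1, ?_, ?_⟩
    · rw [mem_movable, mem_betaSet_succ (h1.trans hm), mem_betaSet_succ (h1.trans hm)]
      refine ⟨Or.inr ⟨by omega, by simpa using hy.1⟩, by omega, ?_⟩
      rintro (h | ⟨-, h⟩)
      · omega
      · rw [show y + 1 - e - 1 = y - e by omega] at h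
        exact hy.2.2 h
    · ext a
      rw [mem_betaSet_succ (h2.trans hm), mem_move, mem_betaSet_succ (h1.trans hm), hmu, mem_move]
      have := hy.2.1
      grind

lemma isHookRemoval_partOfBeta_move {e : ℕ} (he : 0 < e) {lam : Multiset ℕ} {m x : ℕ}
    (hpos : ∀ a ∈ lam, 0 < a) (hm : Multiset.card lam ≤ m) (hx : x ∈ movable e (betaSet lam m)) :
    IsHookRemoval e lam (partOfBeta (move e (betaSet lam m) x)) := by
  have hcard : (move e (betaSet lam m) x).card = m := by rw [card_move hx, card_betaSet]
  have h := mem_movable.1 hx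
  refine ⟨hpos, partOfBeta_pos _, he, m, x, hm, ?_, h.1, h.2.1, h.2.2, ?_⟩
  · exact (card_partOfBeta_le _).trans hcard.le
  · exact (congrArg (betaSet _) hcard.symm).trans (betaSet_partOfBeta _)

lemma isHookRemoval_of_betaSet_eq {e : ℕ} (he : 0 < e) {lam mu : Multiset ℕ} {m x : ℕ}
    (hlam : ∀ a ∈ lam, 0 < a) (hmu : ∀ a ∈ mu, 0 < a) (h1 : Multiset.card lam ≤ m)
    (h2 : Multiset.card mu ≤ m) (hx : x ∈ movable e (betaSet lam m))
    (h : betaSet mu m = move e (betaSet lam m) x) : IsHookRemoval e lam mu := by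
  rw [← partOfBeta_betaSet hmu h2, h]
  exact isHookRemoval_partOfBeta_move he hlam h1 hx

lemma IsHookRemoval.sum_add {e : ℕ} {lam mu : Multiset ℕ} (h : IsHookRemoval e lam mu) :
    mu.sum + e = lam.sum := by
  obtain ⟨m, h1, h2, h3⟩ := h.exists_move
  obtain ⟨x, hx, hmu⟩ := h3 m le_rfl
  have := partOfBeta_move_sum hx
  rwa [← hmu, partOfBeta_betaSet h.1 h1, partOfBeta_betaSet h.2.1 h2] at this

lemma degParity_betaSet_eq_one {lam : Multiset ℕ} {m : ℕ} (h : OddP lam)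
    (hm : Multiset.card lam ≤ m) : degParity (betaSet lam m) = 1 := by
  rw [degParity, partOfBeta_betaSet h.1 hm, ZMod.natCast_eq_one_iff_odd]
  exact h.2

lemma oddP_partOfBeta {S : Finset ℕ} (h : degParity S = 1) : OddP (partOfBeta S) :=
  ⟨partOfBeta_pos S, ZMod.natCast_eq_one_iff_odd.1 h⟩

lemma IsHookRemoval.odd_unique {k : ℕ} {lam mu nu : Multiset ℕ} (hlam : OddP lam)
    (h1 : IsHookRemoval (2 ^ k) lam mu) (hmu : OddP mu)
    (h2 : IsHookRemoval (2 ^ k) lam nu) (hnu : OddP nu) : mu = nu := by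
  obtain ⟨m₁, hl1, hc1, hm1⟩ := h1.exists_move
  obtain ⟨m₂, hl2, hc2, hm2⟩ := h2.exists_move
  obtain ⟨x, hx, hxm⟩ := hm1 (max m₁ m₂) (le_max_left _ _)
  obtain ⟨y, hy, hym⟩ := hm2 (max m₁ m₂) (le_max_right _ _)
  have hc1' := hc1.trans (le_max_left m₁ m₂)
  have hc2' := hc2.trans (le_max_right m₁ m₂)
  have hl' := hl1.trans (le_max_left m₁ m₂)
  have hxy : x = y := movable_odd_unique k lam.sum _ (by rw [partOfBeta_betaSet hlam.1 hl'])
    (degParity_betaSet_eq_one hlam hl') (by have := h1.sum_add; omega) x hx y hy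
    (by rw [← hxm]; exact degParity_betaSet_eq_one hmu hc1')
    (by rw [← hym]; exact degParity_betaSet_eq_one hnu hc2')
  rw [← partOfBeta_betaSet hmu.1 hc1', ← partOfBeta_betaSet hnu.1 hc2', hxm, hym, hxy]

lemma fkOp_spec {k : ℕ} {lam : Multiset ℕ} (hlam : OddP lam) (h : 2 ^ k ≤ lam.sum) :
    IsHookRemoval (2 ^ k) lam (fkOp k lam) ∧ OddP (fkOp k lam) := by
  have hex : ∃ mu, IsHookRemoval (2 ^ k) lam mu ∧ OddP mu := by
    obtain ⟨x, hx, hodd⟩ := exists_movable_odd (degParity_betaSet_eq_one hlam le_rfl)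
      (k := k) (by rwa [partOfBeta_betaSet hlam.1 le_rfl])
    exact ⟨_, isHookRemoval_partOfBeta_move (by positivity) hlam.1 le_rfl hx, oddP_partOfBeta hodd⟩
  rw [fkOp, dif_pos hex]
  exact hex.choose_spec

lemma sub_mul_mem {e : ℕ} {C : Finset ℕ} (hC : ∀ a ∈ C, e ≤ a → a - e ∈ C) {a : ℕ} (ha : a ∈ C)
    (k : ℕ) (hk : k * e ≤ a) : a - k * e ∈ C := by
  induction k with
  | zero => simpa using ha
  | succ k ih =>
    rw [Nat.succ_mul] at hk ⊢
    rw [← Nat.sub_sub]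
    exact hC _ (ih (by omega)) (by omega)

lemma mem_iff_div_lt_card {e : ℕ} (he : 0 < e) {C : Finset ℕ}
    (hC : ∀ a ∈ C, e ≤ a → a - e ∈ C) (x : ℕ) :
    x ∈ C ↔ x / e < (C.filter (fun b => b % e = x % e)).card := by
  have hdiv := Nat.div_add_mod' x e
  constructor
  · intro hx
    have hsub : (Finset.range (x / e + 1)).image (fun q => q * e + x % e) ⊆
        C.filter (fun b => b % e = x % e) := by
      intro a ha
      obtain ⟨q, hq, rfl⟩ := Finset.mem_image.1 ha
      have hq' : q ≤ x / e := by simp at hq; omega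
      obtain ⟨r, hr⟩ := Nat.exists_eq_add_of_le hq'
      rw [Finset.mem_filter]
      refine ⟨?_, by simp [Nat.add_mod]⟩
      rw [hr, add_mul] at hdiv
      have := sub_mul_mem hC hx r (by omega)
      rwa [show x - r * e = q * e + x % e by omega] at this
    have hcard := Finset.card_le_card hsub
    rw [Finset.card_image_of_injective, Finset.card_range] at hcard
    · omega
    · intro a b hab
      exact Nat.eq_of_mul_eq_mul_right he (Nat.add_right_cancel hab)
  · intro hlt
    by_contra hx
    have hmaps : ∀ b ∈ C.filter (fun b => b % e = x % e), b / e ∈ Finset.range (x / e) := by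
      intro b hb
      obtain ⟨hbC, hbm⟩ := Finset.mem_filter.1 hb
      rw [Finset.mem_range]
      by_contra hge
      obtain ⟨r, hr⟩ := Nat.exists_eq_add_of_le (not_lt.1 hge)
      have hbd := Nat.div_add_mod' b e
      rw [hr, add_mul, hbm] at hbd
      have := sub_mul_mem hC hbC r (by omega)
      rw [show b - r * e = x by omega] at this
      exact hx this
    have hinj : Set.InjOn (fun b => b / e) (C.filter (fun b => b % e = x % e) : Finset ℕ) := by
      intro a ha b hb hab
      have ha' := (Finset.mem_filter.1 (Finset.mem_coe.1 ha)).2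
      have hb' := (Finset.mem_filter.1 (Finset.mem_coe.1 hb)).2
      have hab' : a / e = b / e := hab
      rw [← Nat.div_add_mod' a e, ← Nat.div_add_mod' b e, hab', ha', hb']
    have := Finset.card_le_card_of_injOn _ hmaps hinj
    rw [Finset.card_range] at this
    omega

lemma card_filter_mod_move {e : ℕ} {S : Finset ℕ} {z : ℕ} (hz : z ∈ movable e S) (r : ℕ) :
    ((move e S z).filter (fun b => b % e = r)).card = (S.filter (fun b => b % e = r)).card := by
  have h := mem_movable.1 hz
  have hmod : (z - e) % e = z % e := (Nat.mod_eq_sub_mod h.2.1).symm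
  by_cases hr : z % e = r
  · have hz' : z ∈ movable e (S.filter (fun b => b % e = r)) := by
      simp only [mem_movable, Finset.mem_filter]
      exact ⟨⟨h.1, hr⟩, h.2.1, fun hc => h.2.2 hc.1⟩
    rw [← card_move hz']
    congr 1
    ext a
    simp only [Finset.mem_filter, mem_move]
    grind
  · congr 1
    ext a
    simp only [Finset.mem_filter, mem_move]
    grind

lemma coreP_eq_partOfBeta_move {e : ℕ} (he : 0 < e) {lam : Multiset ℕ}
    (hpos : ∀ x ∈ lam, 0 < x) (hsum : lam.sum < 2 * e) {z : ℕ}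
    (hz : z ∈ movable e (betaSet lam (Multiset.card lam + e))) :
    coreP e lam = partOfBeta (move e (betaSet lam (Multiset.card lam + e)) z) := by
  have hcard := card_move hz
  have hs := partOfBeta_move_sum hz
  rw [partOfBeta_betaSet hpos (Nat.le_add_right _ _)] at hs
  have hmod := card_filter_mod_move hz
  rw [card_betaSet] at hcard
  rw [coreP]
  congr 1
  set C := move e (betaSet lam (Multiset.card lam + e)) z
  have hC : ∀ a ∈ C, e ≤ a → a - e ∈ C := fun a ha hae =>
    sub_mem_of_sum_lt (by omega) ha hae
  ext x
  rw [Finset.mem_filter, ← hmod, ← mem_iff_div_lt_card he hC, Finset.mem_range]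
  refine ⟨fun h => h.2, fun h => ⟨?_, h⟩⟩
  have h1 := (mem_iff_div_lt_card he hC x).1 h
  have h2 := Finset.card_filter_le C (fun b => b % e = x % e)
  rw [mul_comm]
  exact (Nat.div_lt_iff_lt_mul he).1 (by omega)

lemma coreP_spec {t : ℕ} {lam : Multiset ℕ} (hlam : OddP lam) (h1 : 2 ^ t ≤ lam.sum)
    (h2 : lam.sum < 2 * 2 ^ t) :
    IsHookRemoval (2 ^ t) lam (coreP (2 ^ t) lam) ∧ OddP (coreP (2 ^ t) lam) := by
  have hle : Multiset.card lam ≤ Multiset.card lam + 2 ^ t := Nat.le_add_right _ _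
  obtain ⟨z, hz, hodd⟩ := exists_movable_odd (degParity_betaSet_eq_one hlam hle)
    (k := t) (by rwa [partOfBeta_betaSet hlam.1 hle])
  rw [coreP_eq_partOfBeta_move (by positivity) hlam.1 h2 hz]
  exact ⟨isHookRemoval_partOfBeta_move (by positivity) hlam.1 hle hz, oddP_partOfBeta hodd⟩

lemma IsHookRemoval.descend {d e : ℕ} (hde : d < e) {lam core mu nu : Multiset ℕ}
    (hsum : lam.sum < 2 * e) (hcore : IsHookRemoval e lam core) (hmu : IsHookRemoval d lam mu)
    (hnu : IsHookRemoval e mu nu) : IsHookRemoval d core nu := by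
  obtain ⟨m₁, hl1, hc1, hm1⟩ := hcore.exists_move
  obtain ⟨m₂, hl2, hc2, hm2⟩ := hmu.exists_move
  obtain ⟨m₃, hl3, hc3, hm3⟩ := hnu.exists_move
  obtain ⟨z, hz, hzm⟩ := hm1 (max m₁ (max m₂ m₃)) (by omega)
  obtain ⟨x, hx, hxm⟩ := hm2 (max m₁ (max m₂ m₃)) (by omega)
  obtain ⟨u, hu, hum⟩ := hm3 (max m₁ (max m₂ m₃)) (by omega)
  rw [hxm] at hu hum
  have hS := partOfBeta_betaSet hcore.1 (show Multiset.card lam ≤ max m₁ (max m₂ m₃) by omega)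
  obtain ⟨h1, h2⟩ := move_move_eq_transfer hmu.2.2.1 hde (by rwa [hS]) hz hx hu
  rw [← hzm] at h1 h2
  exact isHookRemoval_of_betaSet_eq hmu.2.2.1 hcore.2.1 hnu.2.1 (by omega) (by omega) h1
    (hum.trans h2)

theorem stmt9 (t m l : ℕ) (hm : m < 2 ^ t) (hl : 2 ^ l ≤ m)
    (lam : Multiset ℕ) (hodd : OddP lam) (hsum : lam.sum = 2 ^ t + m) :
    OddP (coreP (2 ^ t) lam) ∧ (coreP (2 ^ t) lam).sum = m ∧
      fkOp l (coreP (2 ^ t) lam) = coreP (2 ^ t) (fkOp l lam) := by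
  obtain ⟨hcore, hcore_odd⟩ := coreP_spec hodd (t := t) (by omega) (by omega)
  have hcore_sum := hcore.sum_add
  obtain ⟨hmu, hmu_odd⟩ := fkOp_spec hodd (k := l) (by omega)
  have hmu_sum := hmu.sum_add
  have hpow := Nat.two_pow_pos l
  obtain ⟨hnu, hnu_odd⟩ := coreP_spec hmu_odd (t := t) (by omega) (by omega)
  obtain ⟨hf, hf_odd⟩ := fkOp_spec hcore_odd (k := l) (by omega)
  exact ⟨hcore_odd, by omega, hf.odd_unique hcore_odd hf_odd
    (hcore.descend (by omega) (by omega) hmu hnu) hnu_odd⟩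

end OddSym
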